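/- arXiv:2110.08106 — 2 statements merged into one kernel-verified Lean document; each statement's English description precedes it below -/
import Mathlib

section
/- For every d ∈ ℕ there exists a constant β_d such that the following holds: if M is an n×n binary matrix that is d-twin-ordered, then for every s ∈ {1,...,n}, the cardinality of the s-zone family F_s(M) is at most 2^(β_d·s). -/
/- A binary matrix with `n` rows and `m` columns is modelled as `M : ℕ → ℕ → Bool`,
with the relevant entries `M x y` for `x < n`, `y < m`. Generalized submatrices are
described by a row-index predicate `P` and a column-index predicate `Q`. -/

/-- The submatrix of `M` with rows `P` and columns `Q` is horizontal:
all its columns are equal (equivalently, all its rows are constant). -/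
def IsHoriz (M : ℕ → ℕ → Bool) (P Q : ℕ → Prop) : Prop :=
  ∀ x y y', P x → Q y → Q y' → M x y = M x y'

/-- The submatrix of `M` with rows `P` and columns `Q` is vertical:
all its rows are equal (equivalently, all its columns are constant). -/
def IsVert (M : ℕ → ℕ → Bool) (P Q : ℕ → Prop) : Prop :=
  ∀ x x' y, P x → P x' → Q y → M x y = M x' y

/-- The submatrix of `M` with rows `P` and columns `Q` is constant. -/
def IsConst (M : ℕ → ℕ → Bool) (P Q : ℕ → Prop) : Prop :=
  ∀ x y x' y', P x → Q y → P x' → Q y' → M x y = M x' y'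

/-- Mixed: neither horizontal nor vertical. -/
def IsMixed (M : ℕ → ℕ → Bool) (P Q : ℕ → Prop) : Prop :=
  ¬ IsHoriz M P Q ∧ ¬ IsVert M P Q

/-- A partition of the index interval `[0,n)` into consecutive nonempty blocks is recorded
by its finite set `S` of block starts: it must contain `0` and have all elements `< n`. -/
def IsPartition (n : ℕ) (S : Finset ℕ) : Prop :=
  0 ∈ S ∧ ∀ s ∈ S, s < n

/-- `x` belongs to the block of the partition (of `[0,n)`) with starts `S`
that starts at `s`: `s ≤ x < n`, and no start of `S` lies in `(s, x]`. -/
def InBlock (S : Finset ℕ) (n s x : ℕ) : Prop :=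
  x < n ∧ s ≤ x ∧ ∀ t ∈ S, t ≤ x → t ≤ s

/-- The division of the `n × m` matrix `M` given by row-block starts `R` and
column-block starts `C` has error value at most `d`: every row block and every
column block contains at most `d` non-constant zones. -/
def ErrorValueLe (M : ℕ → ℕ → Bool) (n m : ℕ) (R C : Finset ℕ) (d : ℕ) : Prop :=
  (∀ sr ∈ R, {sc | sc ∈ C ∧ ¬ IsConst M (InBlock R n sr) (InBlock C m sc)}.ncard ≤ d) ∧
  (∀ sc ∈ C, {sr | sr ∈ R ∧ ¬ IsConst M (InBlock R n sr) (InBlock C m sc)}.ncard ≤ d)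

/-- The `n × m` binary matrix `M` is `d`-twin-ordered: there is a contraction sequence,
from the finest division to the coarsest one, each division being obtained from the
previous one by merging two consecutive row blocks or two consecutive column blocks
(i.e. deleting one block start), in which every division has error value at most `d`. -/
def TwinOrdered (n m d : ℕ) (M : ℕ → ℕ → Bool) : Prop :=
  ∃ D : ℕ → Finset ℕ × Finset ℕ,
    D 0 = (Finset.range n, Finset.range m) ∧
    D ((n - 1) + (m - 1)) = ({0}, {0}) ∧
    (∀ k, k < (n - 1) + (m - 1) →
      ((D (k+1)).1 ⊆ (D k).1 ∧ (D k).1.card = (D (k+1)).1.card + 1 ∧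
        (D (k+1)).2 = (D k).2) ∨
      ((D (k+1)).2 ⊆ (D k).2 ∧ (D k).2.card = (D (k+1)).2.card + 1 ∧
        (D (k+1)).1 = (D k).1)) ∧
    (∀ k, k ≤ (n - 1) + (m - 1) → ErrorValueLe M n m (D k).1 (D k).2 d)

/-- The zone of the `s`-regular division of the `n × n` matrix `M` in the intersection of
the `(i+1)`-st row block and the `(j+1)`-st column block, recorded as a triple
(number of rows, number of columns, normalized entry function). -/
def zoneOf (M : ℕ → ℕ → Bool) (n s i j : ℕ) : ℕ × ℕ × (ℕ → ℕ → Bool) :=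
  (min s (n - i * s), min s (n - j * s),
    fun x y =>
      if x < min s (n - i * s) ∧ y < min s (n - j * s) then M (i * s + x) (j * s + y)
      else false)

/-- The `s`-zone family of the `n × n` matrix `M`: the set of distinct matrices occurring
as zones of the `s`-regular division of `M` (equal zones counted once). -/
def ZoneFamily (M : ℕ → ℕ → Bool) (n s : ℕ) : Set (ℕ × ℕ × (ℕ → ℕ → Bool)) :=
  {z | ∃ i j : ℕ, i < (n + s - 1) / s ∧ j < (n + s - 1) / s ∧ z = zoneOf M n s i j}

/-- The contiguous `2 × 2` submatrix of `M` with top left entry `(x, y)` has an odd number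
of true entries. -/
def OddCell (M : ℕ → ℕ → Bool) (x y : ℕ) : Prop :=
  (M x y ^^ M x (y + 1) ^^ M (x + 1) y ^^ M (x + 1) (y + 1)) = true

theorem oddCell_transpose {M : ℕ → ℕ → Bool} {x y : ℕ} (h : OddCell M x y) :
    OddCell (fun a b => M b a) y x := by
  unfold OddCell at *
  dsimp only
  revert h
  cases M x y <;> cases M x (y + 1) <;> cases M (x + 1) y <;> cases M (x + 1) (y + 1) <;> simp

theorem isConst_transpose (M : ℕ → ℕ → Bool) (P Q : ℕ → Prop) :
    IsConst (fun a b => M b a) Q P ↔ IsConst M P Q :=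
  ⟨fun h x y x' y' hx hy hx' hy' => h y x y' x' hy hx hy' hx',
    fun h x y x' y' hx hy hx' hy' => h y x y' x' hy hx hy' hx'⟩

/-- Some block start lies strictly inside the class of label `p`, in the sense that the index
just before it is labelled `p`. -/
def HasBoundary (φ : ℕ → ℕ) (S : Finset ℕ) (p : ℕ) : Prop :=
  ∃ i, φ i = p ∧ i + 1 ∈ S

theorem exists_inBlock {S : Finset ℕ} (h0 : 0 ∈ S) {n x : ℕ} (hx : x < n) :
    ∃ s ∈ S, InBlock S n s x := by
  have hne : (S.filter (· ≤ x)).Nonempty := ⟨0, by simp [h0]⟩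
  have hmem := Finset.max'_mem _ hne
  rw [Finset.mem_filter] at hmem
  exact ⟨_, hmem.1, hx, hmem.2, fun t ht htx => Finset.le_max' _ _ (by simp [ht, htx])⟩

theorem label_eq_of_between {φ : ℕ → ℕ} (hφ : Monotone φ) {a b c p : ℕ} (ha : φ a = p)
    (hc : φ c = p) (hab : a ≤ b) (hbc : b ≤ c) : φ b = p :=
  le_antisymm (hc ▸ hφ hbc) (ha ▸ hφ hab)

theorem inBlock_of_not_hasBoundary {φ : ℕ → ℕ} (hφ : Monotone φ) {S : Finset ℕ} {n p x₀ s x w : ℕ}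
    (hp : ¬ HasBoundary φ S p) (hs : s ∈ S) (hx₀ : φ x₀ = p) (hb : InBlock S n s x₀)
    (hx : φ x = p) (hxw : x ≤ w) (hwx : w ≤ x + 1) (hwn : w < n) : InBlock S n s w := by
  obtain ⟨-, hle, hmax⟩ := hb
  refine ⟨hwn, ?_, fun t ht htw => ?_⟩
  · by_contra! hlt
    exact hp ⟨s - 1, label_eq_of_between hφ hx hx₀ (by omega) (by omega),
      by rwa [Nat.sub_add_cancel (by omega)]⟩
  · by_contra! hlt
    have h1 : x₀ < t := by
      by_contra! h2
      exact absurd (hmax t ht h2) (by omega)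
    exact hp ⟨t - 1, label_eq_of_between hφ hx₀ hx (by omega) (by omega),
      by rwa [Nat.sub_add_cancel (by omega)]⟩

/-- If the label class `p` lies within one row block, then it meets odd cells in at most `2 * d`
column classes containing a column boundary. -/
theorem card_le_of_not_hasBoundary {M : ℕ → ℕ → Bool} {n m d : ℕ} {R C : Finset ℕ}
    (hR : 0 ∈ R) (hC : 0 ∈ C)
    (herr : ∀ sr ∈ R,
      {sc | sc ∈ C ∧ ¬ IsConst M (InBlock R n sr) (InBlock C m sc)}.ncard ≤ d)
    {φ ψ : ℕ → ℕ} (hφ : Monotone φ) (hψ : Monotone ψ) {p : ℕ} (hp : ¬ HasBoundary φ R p)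
    (Y : Finset ℕ) (hY : ∀ q ∈ Y, HasBoundary ψ C q ∧
      ∃ x y, φ x = p ∧ ψ y = q ∧ x + 1 < n ∧ y + 1 < m ∧ OddCell M x y) :
    Y.card ≤ 2 * d := by
  classical
  rcases Y.eq_empty_or_nonempty with rfl | ⟨q₀, hq₀⟩
  · simp
  obtain ⟨-, x₀, -, hx₀, -, hx₀n, -, -⟩ := hY q₀ hq₀
  obtain ⟨sr, hsr, hb⟩ := exists_inBlock hR (show x₀ < n by omega)
  set B := C.filter fun sc => ¬ IsConst M (InBlock R n sr) (InBlock C m sc) with hB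
  have hBd : B.card ≤ d := by
    refine le_trans (le_of_eq ?_) (herr sr hsr)
    rw [← Set.ncard_coe_finset]
    congr 1
    ext sc
    simp [hB]
  let f : ℕ → ℕ := fun sc => ψ (sc - 1)
  let g : ℕ → ℕ := fun sc => ψ (sInf {t | t ∈ C ∧ sc < t} - 1)
  have hsub : Y ⊆ B.image f ∪ B.image g := by
    intro q hq
    obtain ⟨⟨y', hy', hy'C⟩, x, y, hx, hy, hxn, hym, hodd⟩ := hY q hq
    have hbx := inBlock_of_not_hasBoundary hφ hp hsr hx₀ hb hx le_rfl (by omega)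
      (show x < n by omega)
    have hbx' := inBlock_of_not_hasBoundary hφ hp hsr hx₀ hb hx (by omega) le_rfl hxn
    obtain ⟨s₁, hs₁, hb₁⟩ := exists_inBlock hC (show y < m by omega)
    obtain ⟨s₂, hs₂, hb₂⟩ := exists_inBlock hC hym
    have key : ∃ sc ∈ B, ∃ w, y ≤ w ∧ w ≤ y + 1 ∧ InBlock C m sc w := by
      by_cases h₁ : IsConst M (InBlock R n sr) (InBlock C m s₁)
      · by_cases h₂ : IsConst M (InBlock R n sr) (InBlock C m s₂)
        · exfalso
          have e₁ := h₁ x y (x + 1) y hbx hb₁ hbx' hb₁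
          have e₂ := h₂ x (y + 1) (x + 1) (y + 1) hbx hb₂ hbx' hb₂
          unfold OddCell at hodd
          rw [e₁, e₂] at hodd
          revert hodd
          cases M (x + 1) y <;> cases M (x + 1) (y + 1) <;> simp
        · exact ⟨s₂, by simp [hB, hs₂, h₂], y + 1, by omega, le_rfl, hb₂⟩
      · exact ⟨s₁, by simp [hB, hs₁, h₁], y, le_rfl, by omega, hb₁⟩
    obtain ⟨sc, hsc, w, hyw, hwy, -, hscw, hmax⟩ := key
    rw [Finset.mem_union, Finset.mem_image, Finset.mem_image]
    rcases le_or_gt (y' + 1) sc with h | h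
    · exact Or.inl ⟨sc, hsc, label_eq_of_between hψ hy' hy (by omega) (by omega)⟩
    · right
      refine ⟨sc, hsc, ?_⟩
      have hne : {t | t ∈ C ∧ sc < t}.Nonempty := ⟨y' + 1, hy'C, h⟩
      obtain ⟨hnC, hn⟩ := Nat.sInf_mem hne
      have hle : sInf {t | t ∈ C ∧ sc < t} ≤ y' + 1 := Nat.sInf_le ⟨hy'C, h⟩
      have hlt : w < sInf {t | t ∈ C ∧ sc < t} := by
        by_contra! h2
        exact absurd (hmax _ hnC h2) (by omega)
      exact label_eq_of_between hψ hy hy' (by omega) (by omega)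
  calc Y.card ≤ (B.image f ∪ B.image g).card := Finset.card_le_card hsub
    _ ≤ (B.image f).card + (B.image g).card := Finset.card_union_le _ _
    _ ≤ B.card + B.card := add_le_add Finset.card_image_le Finset.card_image_le
    _ ≤ 2 * d := by omega

/-- In a twin-ordered matrix whose rows and columns are grouped into `L` intervals each, only
linearly many zones of the grouping contain odd cells. -/
theorem TwinOrdered.card_oddCell_zones_le {M : ℕ → ℕ → Bool} {n m d : ℕ}
    (hM : TwinOrdered n m d M) {φ ψ : ℕ → ℕ} (hφ : Monotone φ) (hψ : Monotone ψ) {L : ℕ}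
    (X : Finset (ℕ × ℕ)) (hX : ∀ a ∈ X, a.1 < L ∧ a.2 < L ∧
      ∃ x y, φ x = a.1 ∧ ψ y = a.2 ∧ x + 1 < n ∧ y + 1 < m ∧ OddCell M x y) :
    X.card ≤ 4 * d * L := by
  classical
  obtain ⟨D, hD0, hDK, hstep, herr⟩ := hM
  set K := (n - 1) + (m - 1) with hK
  have hzero : ∀ k ≤ K, 0 ∈ (D k).1 ∧ 0 ∈ (D k).2 := by
    intro k hk
    induction hk using Nat.decreasingInduction with
    | self => simp [hDK]
    | of_succ k hk ih =>
      rcases hstep k hk with ⟨h, -, e⟩ | ⟨h, -, e⟩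
      · exact ⟨h ih.1, e ▸ ih.2⟩
      · exact ⟨e ▸ ih.1, h ih.2⟩
  let τ : ℕ → ℕ := fun p => sInf {k | ¬ HasBoundary φ (D k).1 p}
  let σ : ℕ → ℕ := fun q => sInf {k | ¬ HasBoundary ψ (D k).2 q}
  have hτK : ∀ p, K ∈ {k | ¬ HasBoundary φ (D k).1 p} := by
    rintro p ⟨i, -, hi⟩
    simp [hDK] at hi
  have hσK : ∀ q, K ∈ {k | ¬ HasBoundary ψ (D k).2 q} := by
    rintro p ⟨i, -, hi⟩
    simp [hDK] at hi
  have hτ : ∀ p, ¬ HasBoundary φ (D (τ p)).1 p := fun p => Nat.sInf_mem ⟨K, hτK p⟩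
  have hσ : ∀ q, ¬ HasBoundary ψ (D (σ q)).2 q := fun q => Nat.sInf_mem ⟨K, hσK q⟩
  have hτle : ∀ p, τ p ≤ K := fun p => Nat.sInf_le (hτK p)
  have hσle : ∀ q, σ q ≤ K := fun q => Nat.sInf_le (hσK q)
  have hτlt : ∀ p k, k < τ p → HasBoundary φ (D k).1 p := fun p k hk => by
    by_contra h
    exact Nat.notMem_of_lt_sInf hk h
  have hσlt : ∀ q k, k < σ q → HasBoundary ψ (D k).2 q := fun q k hk => by
    by_contra h
    exact Nat.notMem_of_lt_sInf hk h
  have hne : ∀ a ∈ X, τ a.1 ≠ σ a.2 := by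
    intro a ha heq
    obtain ⟨-, -, x, y, hx, hy, hxn, hym, -⟩ := hX a ha
    rcases Nat.eq_zero_or_pos (τ a.1) with h | h
    · apply hτ a.1
      rw [h, hD0]
      exact ⟨x, hx, by simpa using hxn⟩
    · have hK' := hτle a.1
      have e : τ a.1 - 1 + 1 = τ a.1 := by omega
      rcases hstep (τ a.1 - 1) (by omega) with ⟨-, -, h'⟩ | ⟨-, -, h'⟩
      · apply hσ a.2
        rw [← heq, ← e, h']
        exact hσlt _ _ (by omega)
      · apply hτ a.1
        rw [← e, h']
        exact hτlt _ _ (by omega)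
  have hrow : (X.filter fun a => τ a.1 < σ a.2).card ≤ 2 * d * (Finset.range L).card := by
    refine Finset.card_le_mul_card_image_of_maps_to (f := Prod.fst) (fun a ha => ?_) _
      fun p _ => ?_
    · simpa using (hX a (Finset.mem_filter.1 ha).1).1
    · rw [← Finset.card_image_of_injOn (f := Prod.snd)]
      · refine card_le_of_not_hasBoundary (hzero _ (hτle p)).1 (hzero _ (hτle p)).2
          (herr _ (hτle p)).1 hφ hψ (hτ p) _ fun q hq => ?_
        simp only [Finset.mem_image, Finset.mem_filter] at hq
        obtain ⟨a, ⟨⟨haX, hlt⟩, rfl⟩, rfl⟩ := hq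
        exact ⟨hσlt _ _ hlt, (hX a haX).2.2⟩
      · intro a ha b hb hab
        simp only [Finset.coe_filter, Set.mem_ofPred_eq] at ha hb
        exact Prod.ext (ha.2.trans hb.2.symm) hab
  have hcol : (X.filter fun a => ¬ τ a.1 < σ a.2).card ≤ 2 * d * (Finset.range L).card := by
    refine Finset.card_le_mul_card_image_of_maps_to (f := Prod.snd) (fun a ha => ?_) _
      fun q _ => ?_
    · simpa using (hX a (Finset.mem_filter.1 ha).1).2.1
    · rw [← Finset.card_image_of_injOn (f := Prod.fst)]
      · refine card_le_of_not_hasBoundary (M := fun a b => M b a) (n := m) (m := n)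
          (hzero _ (hσle q)).2 (hzero _ (hσle q)).1 ?_ hψ hφ (hσ q) _ fun p hp => ?_
        · simpa only [isConst_transpose] using (herr _ (hσle q)).2
        · simp only [Finset.mem_image, Finset.mem_filter] at hp
          obtain ⟨a, ⟨⟨haX, hlt⟩, rfl⟩, rfl⟩ := hp
          obtain ⟨-, -, x, y, hx, hy, hxn, hym, hodd⟩ := hX a haX
          have := hne a haX
          exact ⟨hτlt _ _ (by omega), y, x, hy, hx, hym, hxn, oddCell_transpose hodd⟩
      · intro a ha b hb hab
        simp only [Finset.coe_filter, Set.mem_ofPred_eq] at ha hb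
        exact Prod.ext hab (ha.2.trans hb.2.symm)
  rw [Finset.card_range] at hrow hcol
  rw [← Finset.card_filter_add_card_filter_not (s := X) (fun a => τ a.1 < σ a.2)]
  calc _ ≤ 2 * d * L + 2 * d * L := add_le_add hrow hcol
    _ = 4 * d * L := by ring

/-- The image of a set of cells under the coarsening of the grid by the factor `u`. -/
def coarsen (u : ℕ) (E : Finset (ℕ × ℕ)) : Finset (ℕ × ℕ) :=
  E.image fun a => (a.1 / u, a.2 / u)

theorem coarsen_coarsen (u v : ℕ) (E : Finset (ℕ × ℕ)) :
    coarsen v (coarsen u E) = coarsen (u * v) E := by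
  simp [coarsen, Finset.image_image, Function.comp_def, Nat.div_div_eq_div_mul]

/-- There are only exponentially many sets of cells of a `2 ^ h × 2 ^ h` grid all of whose
dyadic coarsenings have linear size. -/
theorem exists_finset_of_coarsen_card_le (c h : ℕ) :
    ∃ F : Finset (Finset (ℕ × ℕ)), F.card ≤ 2 ^ (1 + 4 * c * 2 ^ h) ∧
      ∀ E : Finset (ℕ × ℕ), (∀ a ∈ E, a.1 < 2 ^ h ∧ a.2 < 2 ^ h) →
        (∀ t ≤ h, (coarsen (2 ^ t) E).card ≤ c * 2 ^ (h - t)) → E ∈ F := by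
  induction h with
  | zero =>
    refine ⟨({(0, 0)} : Finset (ℕ × ℕ)).powerset, ?_, fun E hE _ => ?_⟩
    · rw [Finset.card_powerset, Finset.card_singleton]
      exact Nat.pow_le_pow_right (by norm_num) (by omega)
    · rw [Finset.mem_powerset]
      intro a ha
      have := hE a ha
      simp only [pow_zero, Nat.lt_one_iff] at this
      simp [Prod.ext_iff, this]
  | succ h ih =>
    obtain ⟨F, hF, hmem⟩ := ih
    let expand : Finset (ℕ × ℕ) → Finset (ℕ × ℕ) := fun E' =>
      E'.biUnion fun a => ({2 * a.1, 2 * a.1 + 1} : Finset ℕ) ×ˢ {2 * a.2, 2 * a.2 + 1}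
    have hexp : ∀ E', (expand E').card ≤ E'.card * 4 := fun E' =>
      Finset.card_biUnion_le_card_mul _ _ _ fun a _ => by
        rw [Finset.card_product]
        exact Nat.mul_le_mul Finset.card_le_two Finset.card_le_two
    refine ⟨(F.filter fun E' => E'.card ≤ c * 2 ^ h).biUnion fun E' => (expand E').powerset,
      ?_, fun E hE hcard => ?_⟩
    · calc _ ≤ (F.filter fun E' => E'.card ≤ c * 2 ^ h).card * 2 ^ (4 * c * 2 ^ h) := by
            refine Finset.card_biUnion_le_card_mul _ _ _ fun E' hE' => ?_
            rw [Finset.card_powerset]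
            refine Nat.pow_le_pow_right (by norm_num) ((hexp E').trans ?_)
            have := (Finset.mem_filter.1 hE').2
            linarith
        _ ≤ 2 ^ (1 + 4 * c * 2 ^ h) * 2 ^ (4 * c * 2 ^ h) :=
            Nat.mul_le_mul_right _ ((Finset.card_filter_le _ _).trans hF)
        _ = 2 ^ (1 + 4 * c * 2 ^ (h + 1)) := by
            rw [← pow_add]
            congr 1
            ring
    · rw [Finset.mem_biUnion]
      refine ⟨coarsen 2 E, Finset.mem_filter.2 ⟨hmem _ ?_ ?_, ?_⟩, ?_⟩
      · intro a ha
        obtain ⟨b, hb, rfl⟩ := Finset.mem_image.1 ha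
        have := hE b hb
        rw [pow_succ] at this
        exact ⟨by dsimp only; omega, by dsimp only; omega⟩
      · intro t ht
        rw [coarsen_coarsen, ← pow_succ']
        simpa using hcard (t + 1) (by omega)
      · simpa using hcard 1 (by omega)
      · rw [Finset.mem_powerset]
        intro a ha
        refine Finset.mem_biUnion.2 ⟨(a.1 / 2, a.2 / 2), Finset.mem_image_of_mem _ ha, ?_⟩
        simp only [Finset.mem_product, Finset.mem_insert, Finset.mem_singleton]
        omega

open Classical in
/-- The dimensions, first row, first column and odd cells of a matrix, given as in `zoneOf`,
with at most `s` rows and columns. -/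
noncomputable def zoneCode (s : ℕ) (z : ℕ × ℕ × (ℕ → ℕ → Bool)) :
    ℕ × ℕ × Finset ℕ × Finset ℕ × Finset (ℕ × ℕ) :=
  (z.1, z.2.1, (Finset.range s).filter fun y => z.2.2 0 y = true,
    (Finset.range s).filter fun x => z.2.2 x 0 = true,
    (Finset.range s ×ˢ Finset.range s).filter fun a =>
      a.1 + 1 < z.1 ∧ a.2 + 1 < z.2.1 ∧ OddCell z.2.2 a.1 a.2)

theorem mem_zoneCode_oddCells {s : ℕ} {z : ℕ × ℕ × (ℕ → ℕ → Bool)} {a : ℕ × ℕ} :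
    a ∈ (zoneCode s z).2.2.2.2 ↔
      (a.1 < s ∧ a.2 < s) ∧ a.1 + 1 < z.1 ∧ a.2 + 1 < z.2.1 ∧ OddCell z.2.2 a.1 a.2 := by
  simp [zoneCode]

/-- A matrix is determined by its first row, its first column and its odd cells. -/
theorem zoneCode_injOn (s : ℕ) :
    Set.InjOn (zoneCode s) {z | z.1 ≤ s ∧ z.2.1 ≤ s ∧
      ∀ x y, ¬ (x < z.1 ∧ y < z.2.1) → z.2.2 x y = false} := by
  rintro ⟨a, b, f⟩ ⟨ha, hb, hf⟩ ⟨a', b', g⟩ ⟨-, -, hg⟩ heq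
  simp only [zoneCode, Prod.mk.injEq] at heq ha hb hf hg
  obtain ⟨rfl, rfl, hrow, hcol, hodd⟩ := heq
  simp only [Finset.ext_iff, Finset.mem_filter, Finset.mem_range, Finset.mem_product,
    Prod.forall, and_congr_right_iff] at hrow hcol hodd
  suffices h : ∀ x y, x < a → y < b → f x y = g x y by
    simp only [Prod.mk.injEq, true_and]
    funext x y
    by_cases hxy : x < a ∧ y < b
    · exact h x y hxy.1 hxy.2
    · rw [hf x y hxy, hg x y hxy]
  intro x
  induction x with
  | zero => exact fun y _ hy => Bool.eq_iff_iff.2 (hrow y (by omega))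
  | succ x ihx =>
    intro y
    induction y with
    | zero => exact fun hx _ => Bool.eq_iff_iff.2 (hcol (x + 1) (by omega))
    | succ y ihy =>
      intro hx hy
      have h := hodd x y ⟨by omega, by omega⟩ hx hy
      unfold OddCell at h
      rw [ihx y (by omega) (by omega), ihx (y + 1) (by omega) hy, ihy hx (by omega)] at h
      revert h
      cases g x y <;> cases g x (y + 1) <;> cases g (x + 1) y <;> cases g (x + 1) (y + 1) <;>
        cases f (x + 1) (y + 1) <;> simp

theorem TwinOrdered.card_coarsen_zoneCode_le {M : ℕ → ℕ → Bool} {n d : ℕ}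
    (hM : TwinOrdered n n d M) (s i j h t : ℕ) (hs : s ≤ 2 ^ h) (ht : t ≤ h) :
    (coarsen (2 ^ t) (zoneCode s (zoneOf M n s i j)).2.2.2.2).card ≤ 4 * d * 2 ^ (h - t) := by
  have hmono : ∀ k, Monotone fun x => (x - k) / 2 ^ t := fun k x y hxy =>
    Nat.div_le_div_right (by omega)
  refine hM.card_oddCell_zones_le (hmono (i * s)) (hmono (j * s)) _ fun a ha => ?_
  obtain ⟨⟨x, y⟩, hxy, rfl⟩ := Finset.mem_image.1 ha
  obtain ⟨⟨hxs, hys⟩, hx, hy, hodd⟩ := mem_zoneCode_oddCells.1 hxy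
  simp only [zoneOf] at hxs hys hx hy hodd
  have hlt : ∀ w < s, w / 2 ^ t < 2 ^ (h - t) := fun w hw => by
    rw [Nat.div_lt_iff_lt_mul (by positivity), ← pow_add, Nat.sub_add_cancel ht]
    omega
  refine ⟨hlt x hxs, hlt y hys, i * s + x, j * s + y, by simp, by simp, by omega, by omega, ?_⟩
  unfold OddCell at hodd ⊢
  have hx' : x < min s (n - i * s) := by omega
  have hy' : y < min s (n - j * s) := by omega
  simpa only [hx, hy, hx', hy', and_self, if_true, add_assoc] using hodd

/-- For every `d` there is a constant `β` such that for every `n × n` binary matrix `M`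
that is `d`-twin-ordered and every `s ∈ {1, …, n}`, the `s`-zone family of `M` has
cardinality at most `2 ^ (β * s)`. -/
theorem zone_family_exponential_bound (d : ℕ) :
    ∃ β : ℕ, ∀ n : ℕ, ∀ M : ℕ → ℕ → Bool,
      TwinOrdered n n d M →
      ∀ s : ℕ, 1 ≤ s → s ≤ n → (ZoneFamily M n s).ncard ≤ 2 ^ (β * s) := by
  refine ⟨5 + 32 * d, fun n M hM s hs1 hsn => ?_⟩
  set h := Nat.clog 2 s with hh
  have hsh : s ≤ 2 ^ h := Nat.le_pow_clog (by norm_num) s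
  have hhs : 2 ^ h ≤ 2 * s := by
    rcases Nat.lt_or_ge 1 s with h1 | h1
    · have h2 := Nat.pow_pred_clog_lt_self (b := 2) (by norm_num) h1
      have h3 : 0 < h := Nat.clog_pos (by norm_num) h1
      obtain ⟨k, hk⟩ := Nat.exists_eq_succ_of_ne_zero h3.ne'
      rw [← hh, hk, Nat.pred_succ] at h2
      rw [hk, pow_succ]
      omega
    · obtain rfl : s = 1 := le_antisymm h1 hs1
      simp [hh]
  obtain ⟨F, hF, hmem⟩ := exists_finset_of_coarsen_card_le (4 * d) h
  let T := Finset.range (s + 1) ×ˢ Finset.range (s + 1) ×ˢ (Finset.range s).powerset ×ˢ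
    (Finset.range s).powerset ×ˢ F
  have hT : T.card ≤ 2 ^ ((5 + 32 * d) * s) := by
    have hs2 : s + 1 ≤ 2 ^ s := Nat.lt_two_pow_self
    have hF' : F.card ≤ 2 ^ ((1 + 32 * d) * s) := by
      refine hF.trans (Nat.pow_le_pow_right (by norm_num) ?_)
      have := Nat.mul_le_mul_left (16 * d) hhs
      linarith
    calc T.card = (s + 1) * ((s + 1) * (2 ^ s * (2 ^ s * F.card))) := by
          simp [T, Finset.card_product]
      _ ≤ 2 ^ s * (2 ^ s * (2 ^ s * (2 ^ s * 2 ^ ((1 + 32 * d) * s)))) := by gcongr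
      _ = 2 ^ ((5 + 32 * d) * s) := by
          simp only [← pow_add]
          congr 1
          ring
  refine le_trans ?_ hT
  rw [← Set.ncard_coe_finset]
  refine Set.ncard_le_ncard_of_injOn (zoneCode s) ?_ ((zoneCode_injOn s).mono ?_)
    (Finset.finite_toSet _)
  · rintro z ⟨i, j, -, -, rfl⟩
    simp only [T, Finset.coe_product, Set.mem_prod, Finset.mem_coe]
    refine ⟨?_, ?_, ?_, ?_, hmem _ (fun a ha => ?_) fun t ht =>
      hM.card_coarsen_zoneCode_le s i j h t hsh ht⟩
    · simp only [zoneCode, zoneOf, Finset.mem_range]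
      omega
    · simp only [zoneCode, zoneOf, Finset.mem_range]
      omega
    · exact Finset.mem_powerset.2 (Finset.filter_subset _ _)
    · exact Finset.mem_powerset.2 (Finset.filter_subset _ _)
    · have := (mem_zoneCode_oddCells.1 ha).1
      omega
  · rintro z ⟨i, j, -, -, rfl⟩
    exact ⟨min_le_left _ _, min_le_left _ _, fun x y hxy => if_neg hxy⟩
end

section
/- Let M be an n×n binary matrix that is d-twin-ordered, and let N ≥ n. Then the N×N binary matrix obtained from M by appending N−n new rows at the bottom and N−n new columns on the right, with all new entries equal to 0, is (d+1)-twin-ordered. -/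
/-- One division is obtained from another by merging two consecutive row blocks or two
consecutive column blocks. -/
def IsContraction (A B : Finset ℕ × Finset ℕ) : Prop :=
  (B.1 ⊆ A.1 ∧ A.1.card = B.1.card + 1 ∧ B.2 = A.2) ∨
  (B.2 ⊆ A.2 ∧ A.2.card = B.2.card + 1 ∧ B.1 = A.1)

/-- There is a sequence of `L` contractions from `A` to `B` through divisions satisfying `P`. -/
def ContractionChain (P : Finset ℕ × Finset ℕ → Prop) (L : ℕ) (A B : Finset ℕ × Finset ℕ) :
    Prop :=
  ∃ D : ℕ → Finset ℕ × Finset ℕ, D 0 = A ∧ D L = B ∧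
    (∀ k, k < L → IsContraction (D k) (D (k + 1))) ∧ ∀ k, k ≤ L → P (D k)

theorem ContractionChain.trans {P : Finset ℕ × Finset ℕ → Prop} {L₁ L₂ : ℕ}
    {A B C : Finset ℕ × Finset ℕ} (h₁ : ContractionChain P L₁ A B)
    (h₂ : ContractionChain P L₂ B C) : ContractionChain P (L₁ + L₂) A C := by
  obtain ⟨D, hD0, hDL, hDs, hDP⟩ := h₁
  obtain ⟨E, hE0, hEL, hEs, hEP⟩ := h₂
  refine ⟨fun k => if k ≤ L₁ then D k else E (k - L₁), by simpa using hD0, ?_, ?_, ?_⟩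
  · rcases Nat.eq_zero_or_pos L₂ with rfl | h
    · simp [hDL, ← hEL, hE0]
    · simp [hEL, h.ne']
  · intro k hk
    rcases lt_trichotomy k L₁ with h | rfl | h
    · simpa [h.le, Nat.succ_le_of_lt h] using hDs k h
    · simpa [hDL, ← hE0] using hEs 0 (by omega)
    · have := hEs (k - L₁) (by omega)
      rw [show k - L₁ + 1 = k + 1 - L₁ by omega] at this
      simpa [h.not_ge, show ¬ k + 1 ≤ L₁ by omega] using this
  · intro k hk
    by_cases h : k ≤ L₁
    · simpa [h] using hDP k h
    · simpa [h] using hEP (k - L₁) (by omega)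

theorem ContractionChain.single {P : Finset ℕ × Finset ℕ → Prop} {A B : Finset ℕ × Finset ℕ}
    (h : IsContraction A B) (hA : P A) (hB : P B) : ContractionChain P 1 A B := by
  refine ⟨fun k => if k = 0 then A else B, by simp, by simp, ?_, ?_⟩
  · intro k hk
    obtain rfl : k = 0 := by omega
    simpa using h
  · intro k _
    dsimp only
    split_ifs <;> assumption

theorem IsContraction.subset_of_forall {L : ℕ}
    {D : ℕ → Finset ℕ × Finset ℕ} (h : ∀ k, k < L → IsContraction (D k) (D (k + 1))) (k : ℕ)
    (hk : k ≤ L) : (D k).1 ⊆ (D 0).1 ∧ (D k).2 ⊆ (D 0).2 := by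
  induction k with
  | zero => simp
  | succ k ih =>
    obtain ⟨h₁, h₂⟩ := ih (by omega)
    rcases h k (by omega) with ⟨hs, -, he⟩ | ⟨hs, -, he⟩
    · exact ⟨hs.trans h₁, he ▸ h₂⟩
    · exact ⟨he ▸ h₁, hs.trans h₂⟩

/-- Adding a common new block start to all partitions preserves contractions. -/
theorem IsContraction.insert {A B : Finset ℕ × Finset ℕ} {n : ℕ} (h : IsContraction A B)
    (h₁ : n ∉ A.1) (h₂ : n ∉ A.2) :
    IsContraction (insert n A.1, insert n A.2) (insert n B.1, insert n B.2) := by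
  rcases h with ⟨hs, hc, he⟩ | ⟨hs, hc, he⟩
  · refine Or.inl ⟨Finset.insert_subset_insert _ hs, ?_, by simp [he]⟩
    simp [Finset.card_insert_of_notMem h₁, Finset.card_insert_of_notMem (fun h => h₁ (hs h)), hc]
  · refine Or.inr ⟨Finset.insert_subset_insert _ hs, ?_, by simp [he]⟩
    simp [Finset.card_insert_of_notMem h₂, Finset.card_insert_of_notMem (fun h => h₂ (hs h)), hc]

/-- If every non-constant zone of a division of `M'` is also a non-constant zone of a division
of `M`, then the error value does not increase. -/
theorem ErrorValueLe.of_nonconst {M M' : ℕ → ℕ → Bool} {n m n' m' d : ℕ}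
    {R C R' C' : Finset ℕ} (h : ErrorValueLe M n m R C d)
    (H : ∀ sr ∈ R', ∀ sc ∈ C', ¬ IsConst M' (InBlock R' n' sr) (InBlock C' m' sc) →
      sr ∈ R ∧ sc ∈ C ∧ ¬ IsConst M (InBlock R n sr) (InBlock C m sc)) :
    ErrorValueLe M' n' m' R' C' d := by
  constructor
  · intro sr hsr
    by_cases hr : sr ∈ R
    · refine le_trans (Set.ncard_le_ncard ?_ ?_) (h.1 sr hr)
      · exact fun sc hsc => (H sr hsr sc hsc.1 hsc.2).2
      · exact C.finite_toSet.subset fun sc hsc => hsc.1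
    · convert Nat.zero_le d
      rw [Set.ncard_eq_zero (C'.finite_toSet.subset fun sc hsc => hsc.1)]
      exact Set.eq_empty_of_forall_notMem fun sc hsc => hr (H sr hsr sc hsc.1 hsc.2).1
  · intro sc hsc
    by_cases hc : sc ∈ C
    · refine le_trans (Set.ncard_le_ncard ?_ ?_) (h.2 sc hc)
      · exact fun sr hsr => ⟨(H sr hsr.1 sc hsc hsr.2).1, (H sr hsr.1 sc hsc hsr.2).2.2⟩
      · exact R.finite_toSet.subset fun sr hsr => hsr.1
    · convert Nat.zero_le d
      rw [Set.ncard_eq_zero (R'.finite_toSet.subset fun sr hsr => hsr.1)]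
      exact Set.eq_empty_of_forall_notMem fun sr hsr => hc (H sr hsr.1 sc hsc hsr.2).2.1

theorem ErrorValueLe.mono {M : ℕ → ℕ → Bool} {n m d d' : ℕ} {R C : Finset ℕ}
    (h : ErrorValueLe M n m R C d) (hd : d ≤ d') : ErrorValueLe M n m R C d' :=
  ⟨fun s hs => (h.1 s hs).trans hd, fun s hs => (h.2 s hs).trans hd⟩

/-- A division whose only possibly non-constant zone is induced by one fixed pair of blocks
has error value at most one. -/
theorem errorValueLe_one_of_forall_eq {M : ℕ → ℕ → Bool} {n m r c : ℕ} {R C : Finset ℕ}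
    (H : ∀ sr ∈ R, ∀ sc ∈ C, ¬ IsConst M (InBlock R n sr) (InBlock C m sc) →
      sr = r ∧ sc = c) :
    ErrorValueLe M n m R C 1 := by
  constructor
  · intro sr hsr
    rw [← Set.ncard_singleton c]
    exact Set.ncard_le_ncard fun sc hsc => (H sr hsr sc hsc.1 hsc.2).2
  · intro sc hsc
    rw [← Set.ncard_singleton r]
    exact Set.ncard_le_ncard fun sr hsr => (H sr hsr.1 sc hsc hsr.2).1

/-- The matrix that agrees with `M` on the first `n` rows and columns and is `0` elsewhere. -/
def padZero (n : ℕ) (M : ℕ → ℕ → Bool) : ℕ → ℕ → Bool :=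
  fun x y => if x < n ∧ y < n then M x y else false

theorem padZero_of_lt {n x y : ℕ} {M : ℕ → ℕ → Bool} (hx : x < n) (hy : y < n) :
    padZero n M x y = M x y := by
  simp [padZero, hx, hy]

theorem padZero_of_le_left {n x : ℕ} {M : ℕ → ℕ → Bool} (hx : n ≤ x) (y : ℕ) :
    padZero n M x y = false := by
  simp [padZero, hx.not_gt]

theorem padZero_of_le_right {n y : ℕ} {M : ℕ → ℕ → Bool} (x : ℕ) (hy : n ≤ y) :
    padZero n M x y = false := by
  simp [padZero, hy.not_gt]

theorem isConst_padZero_of_le_left {n : ℕ} {M : ℕ → ℕ → Bool} {P Q : ℕ → Prop}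
    (h : ∀ x, P x → n ≤ x) : IsConst (padZero n M) P Q := by
  intro x y x' y' hx _ hx' _
  rw [padZero_of_le_left (h x hx), padZero_of_le_left (h x' hx')]

theorem isConst_padZero_of_le_right {n : ℕ} {M : ℕ → ℕ → Bool} {P Q : ℕ → Prop}
    (h : ∀ y, Q y → n ≤ y) : IsConst (padZero n M) P Q := by
  intro x y x' y' _ hy _ hy'
  rw [padZero_of_le_right x (h y hy), padZero_of_le_right x' (h y' hy')]

theorem isConst_padZero_of_isConst {n : ℕ} {M : ℕ → ℕ → Bool} {P Q P' Q' : ℕ → Prop}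
    (h : IsConst M P Q) (hP : ∀ x, P' x → P x ∧ x < n) (hQ : ∀ y, Q' y → Q y ∧ y < n) :
    IsConst (padZero n M) P' Q' := by
  intro x y x' y' hx hy hx' hy'
  rw [padZero_of_lt (hP x hx).2 (hQ y hy).2, padZero_of_lt (hP x' hx').2 (hQ y' hy').2]
  exact h x y x' y' (hP x hx).1 (hQ y hy).1 (hP x' hx').1 (hQ y' hy').1

theorem InBlock.eq_of_range {a N s x : ℕ} (h : InBlock (Finset.range a) N s x)
    (hs : s + 1 < a) : x = s := by
  obtain ⟨-, h₁, h₂⟩ := h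
  have := h₂ (s + 1) (by simpa using hs)
  omega

theorem InBlock.of_insert {S : Finset ℕ} {n N s x : ℕ} (h : InBlock (insert n S) N s x)
    (hs : s < n) : InBlock S n s x ∧ x < n := by
  obtain ⟨-, h₁, h₂⟩ := h
  have hx : x < n := by
    have := h₂ n (by simp)
    omega
  exact ⟨⟨hx, h₁, fun t ht => h₂ t (Finset.mem_insert_of_mem ht)⟩, hx⟩

theorem errorValueLe_padZero_range {n N a b d : ℕ} (M : ℕ → ℕ → Bool) (ha : n < a)
    (hb : n < b) : ErrorValueLe (padZero n M) N N (Finset.range a) (Finset.range b) d := by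
  have h : ErrorValueLe M N N ∅ ∅ d := by simp [ErrorValueLe]
  refine h.of_nonconst fun sr _ sc _ hne => absurd ?_ hne
  rcases le_or_gt n sr with hr | hr
  · exact isConst_padZero_of_le_left fun x hx => hr.trans hx.2.1
  rcases le_or_gt n sc with hc | hc
  · exact isConst_padZero_of_le_right fun y hy => hc.trans hy.2.1
  intro x y x' y' hx hy hx' hy'
  rw [hx.eq_of_range (by omega), hx'.eq_of_range (by omega), hy.eq_of_range (by omega),
    hy'.eq_of_range (by omega)]

theorem errorValueLe_padZero_insert {n N d : ℕ} {M : ℕ → ℕ → Bool} {R C : Finset ℕ}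
    (h : ErrorValueLe M n n R C d) (hR : R ⊆ Finset.range n) (hC : C ⊆ Finset.range n) :
    ErrorValueLe (padZero n M) N N (insert n R) (insert n C) d := by
  refine h.of_nonconst fun sr hsr sc hsc hne => ?_
  rcases Finset.mem_insert.1 hsr with rfl | hr
  · exact absurd (isConst_padZero_of_le_left fun x hx => hx.2.1) hne
  rcases Finset.mem_insert.1 hsc with rfl | hc
  · exact absurd (isConst_padZero_of_le_right fun y hy => hy.2.1) hne
  exact ⟨hr, hc, fun hconst => hne <| isConst_padZero_of_isConst hconst
    (fun x hx => hx.of_insert (Finset.mem_range.1 (hR hr)))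
    (fun y hy => hy.of_insert (Finset.mem_range.1 (hC hc)))⟩

theorem errorValueLe_padZero_self {n d : ℕ} {M : ℕ → ℕ → Bool} {R C : Finset ℕ}
    (h : ErrorValueLe M n n R C d) : ErrorValueLe (padZero n M) n n R C d :=
  h.of_nonconst fun _ hr _ hc hne => ⟨hr, hc, fun hconst => hne <|
    isConst_padZero_of_isConst hconst (fun _ hx => ⟨hx, hx.1⟩) (fun _ hy => ⟨hy, hy.1⟩)⟩

theorem isContraction_range_left (a : ℕ) (C : Finset ℕ) :
    IsContraction (Finset.range (a + 1), C) (Finset.range a, C) :=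
  Or.inl ⟨Finset.range_mono a.le_succ, by simp, rfl⟩

theorem isContraction_range_right (R : Finset ℕ) (b : ℕ) :
    IsContraction (R, Finset.range (b + 1)) (R, Finset.range b) :=
  Or.inr ⟨Finset.range_mono b.le_succ, by simp, rfl⟩

theorem contractionChain_range_left {P : Finset ℕ × Finset ℕ → Prop} (a p : ℕ) (C : Finset ℕ)
    (hP : ∀ k, a ≤ k → P (Finset.range k, C)) :
    ContractionChain P p (Finset.range (a + p), C) (Finset.range a, C) := by
  refine ⟨fun k => (Finset.range (a + p - k), C), by simp, by simp, fun k hk => ?_,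
    fun k hk => hP _ (by omega)⟩
  simpa [show a + p - (k + 1) + 1 = a + p - k by omega] using
    isContraction_range_left (a + p - (k + 1)) C

theorem contractionChain_range_right {P : Finset ℕ × Finset ℕ → Prop} (R : Finset ℕ) (b p : ℕ)
    (hP : ∀ k, b ≤ k → P (R, Finset.range k)) :
    ContractionChain P p (R, Finset.range (b + p)) (R, Finset.range b) := by
  refine ⟨fun k => (R, Finset.range (b + p - k)), by simp, by simp, fun k hk => ?_,
    fun k hk => hP _ (by omega)⟩
  simpa [show b + p - (k + 1) + 1 = b + p - k by omega] using
    isContraction_range_right R (b + p - (k + 1))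

theorem contractionChain_padZero_insert {n N d L : ℕ} {M : ℕ → ℕ → Bool}
    {B : Finset ℕ × Finset ℕ}
    (h : ContractionChain (fun A => ErrorValueLe M n n A.1 A.2 d) L
      (Finset.range n, Finset.range n) B) :
    ContractionChain (fun A => ErrorValueLe (padZero n M) N N A.1 A.2 d) L
      (Finset.range (n + 1), Finset.range (n + 1)) (insert n B.1, insert n B.2) := by
  obtain ⟨D, h0, hL, hs, hP⟩ := h
  have hsub : ∀ k, k ≤ L → (D k).1 ⊆ Finset.range n ∧ (D k).2 ⊆ Finset.range n := by
    intro k hk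
    simpa [h0] using IsContraction.subset_of_forall hs k hk
  refine ⟨fun k => (insert n (D k).1, insert n (D k).2), by simp [h0, Finset.range_add_one],
    by simp [hL], fun k hk => ?_, fun k hk => ?_⟩
  · obtain ⟨h₁, h₂⟩ := hsub k hk.le
    exact (hs k hk).insert (fun h => by simpa using h₁ h) (fun h => by simpa using h₂ h)
  · exact errorValueLe_padZero_insert (hP k hk) (hsub k hk).1 (hsub k hk).2

/-- The last two contractions: merge the two row blocks, then the two column blocks. -/
theorem contractionChain_padZero_coarsest {n N d : ℕ} (M : ℕ → ℕ → Bool) (hn : n ≠ 0) :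
    ContractionChain (fun A => ErrorValueLe (padZero n M) N N A.1 A.2 (d + 1)) 2
      (insert n {0}, insert n {0}) ({0}, {0}) := by
  have err : ∀ R C : Finset ℕ, R ⊆ {n, 0} → C ⊆ {n, 0} →
      ErrorValueLe (padZero n M) N N R C (d + 1) := by
    intro R C hR hC
    refine (errorValueLe_one_of_forall_eq (r := 0) (c := 0) ?_).mono (by omega)
    intro sr hsr sc hsc hne
    have hr := hR hsr
    have hc := hC hsc
    simp only [Finset.mem_insert, Finset.mem_singleton] at hr hc
    rcases hr with rfl | rfl
    · exact absurd (isConst_padZero_of_le_left fun x hx => hx.2.1) hne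
    rcases hc with rfl | rfl
    · exact absurd (isConst_padZero_of_le_right fun y hy => hy.2.1) hne
    exact ⟨rfl, rfl⟩
  refine ContractionChain.trans (L₁ := 1) (L₂ := 1) (B := ({0}, {n, 0}))
    (.single (Or.inl ⟨?_, ?_, rfl⟩) (err _ _ ?_ ?_) (err _ _ ?_ ?_))
    (.single (Or.inr ⟨?_, ?_, rfl⟩) (err _ _ ?_ ?_) (err _ _ ?_ ?_))
  all_goals simp [hn]

/-- If the `n × n` binary matrix `M` is `d`-twin-ordered and `N ≥ n`, then the `N × N`
matrix obtained from `M` by appending `N - n` new all-`0` rows at the bottom and `N - n`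
new all-`0` columns on the right is `(d+1)`-twin-ordered. -/
theorem padded_matrix_twinOrdered (n N d : ℕ) (M : ℕ → ℕ → Bool)
    (hn : n ≤ N) (hM : TwinOrdered n n d M) :
    TwinOrdered N N (d + 1) (fun x y => if x < n ∧ y < n then M x y else false) := by
  have hn0 : n ≠ 0 := by
    rintro rfl
    obtain ⟨D, h0, h1, -⟩ := hM
    simp [h0] at h1
  obtain ⟨p, rfl⟩ := Nat.exists_eq_add_of_le hn
  rcases Nat.eq_zero_or_pos p with rfl | hp
  · obtain ⟨D, h0, h1, hs, he⟩ := hM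
    exact ⟨D, h0, h1, hs, fun k hk =>
      errorValueLe_padZero_self ((he k hk).mono d.le_succ)⟩
  obtain ⟨q, rfl⟩ : ∃ q, p = 1 + q := Nat.exists_eq_add_of_le hp
  rw [← add_assoc] at *
  have hM' : ContractionChain (fun A => ErrorValueLe M n n A.1 A.2 (d + 1))
      ((n - 1) + (n - 1)) (Finset.range n, Finset.range n) ({0}, {0}) := by
    obtain ⟨D, h0, h1, hs, he⟩ := hM
    exact ⟨D, h0, h1, hs, fun k hk => (he k hk).mono d.le_succ⟩
  have h := (((contractionChain_range_left
      (P := fun A => ErrorValueLe (padZero n M) (n + 1 + q) (n + 1 + q) A.1 A.2 (d + 1))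
      (n + 1) q (Finset.range (n + 1 + q))
      fun k hk => errorValueLe_padZero_range M (by omega) (by omega)).trans
    (contractionChain_range_right _ (n + 1) q
      fun k hk => errorValueLe_padZero_range M (by omega) (by omega))).trans
    (contractionChain_padZero_insert hM')).trans
    (contractionChain_padZero_coarsest M hn0)
  rw [show q + q + (n - 1 + (n - 1)) + 2 = (n + 1 + q - 1) + (n + 1 + q - 1) by omega] at h
  exact h
end
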